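/- arXiv:1702.03057 — 2 statements merged into one kernel-verified Lean document; each statement's English description precedes it below -/
import Mathlib

section
/- (L² bound from the proof of Proposition 3.2) Let (S_α)_{α ∈ ℕ^d} be square-integrable real random variables, and let N be an ℕ^d-valued random variable independent of the family (S_α), with P(N ≥ α) > 0 for all α in a finite set J ⊆ ℕ^d. Then ‖ Σ_{α ∈ J} ΔS_α · 1_{{N ≥ α}} / P(N ≥ α) ‖₂² ≤ Σ_{α, β ∈ J} ‖ΔS_α‖₂ ‖ΔS_β‖₂ / P(N ≥ α ∨ β), where ‖·‖₂ is the L² norm and α ∨ β is the componentwise maximum. -/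
open MeasureTheory ProbabilityTheory

/-- The `i`-th difference operator: `(Δ_i S)_α = S_α − S_{α−e_i}` if `α_i > 0`,
and `(Δ_i S)_α = S_α` if `α_i = 0`. -/
def diffOp {d : ℕ} {V : Type*} [AddCommGroup V] [Module ℝ V]
    (i : Fin d) (S : (Fin d → ℕ) → V) : (Fin d → ℕ) → V :=
  fun α => if α i = 0 then S α else S α - S (Function.update α i (α i - 1))

/-- The mixed difference operator `Δ = Δ_1 ∘ ⋯ ∘ Δ_d`. -/
def mixedDiff {d : ℕ} {V : Type*} [AddCommGroup V] [Module ℝ V]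
    (S : (Fin d → ℕ) → V) : (Fin d → ℕ) → V :=
  (List.finRange d).foldr (fun i T => diffOp i T) S

lemma measurable_mixedDiff_apply {d : ℕ} (α : Fin d → ℕ) :
    Measurable (fun s : (Fin d → ℕ) → ℝ => mixedDiff s α) := by
  unfold mixedDiff
  induction List.finRange d generalizing α with
  | nil => exact measurable_pi_apply α
  | cons i l ih =>
    simp only [List.foldr_cons, diffOp]
    split_ifs
    · exact ih α
    · exact (ih α).sub (ih _)

lemma memLp_mixedDiff {d : ℕ} {Ω : Type*} {mΩ : MeasurableSpace Ω} {μ : Measure Ω}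
    {p : ENNReal} {S : (Fin d → ℕ) → Ω → ℝ} (hS : ∀ α, MemLp (S α) p μ) (α : Fin d → ℕ) :
    MemLp (fun ω => mixedDiff (fun β => S β ω) α) p μ := by
  unfold mixedDiff
  induction List.finRange d generalizing α with
  | nil => exact hS α
  | cons i l ih =>
    simp only [List.foldr_cons, diffOp]
    split_ifs
    · exact ih α
    · exact (ih α).sub (ih _)

lemma inner_toLp_eq_integral_mul {Ω : Type*} {mΩ : MeasurableSpace Ω} {μ : Measure Ω}
    {f g : Ω → ℝ} (hf : MemLp f 2 μ) (hg : MemLp g 2 μ) :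
    inner ℝ (hf.toLp f) (hg.toLp g) = ∫ ω, f ω * g ω ∂μ := by
  rw [L2.inner_def]
  refine integral_congr_ae ?_
  filter_upwards [hf.coeFn_toLp, hg.coeFn_toLp] with ω h₁ h₂
  simp [h₁, h₂, mul_comm]

lemma toReal_eLpNorm_two_sq_eq_integral {Ω : Type*} {mΩ : MeasurableSpace Ω} {μ : Measure Ω}
    {f : Ω → ℝ} (hf : MemLp f 2 μ) :
    (eLpNorm f 2 μ).toReal ^ 2 = ∫ ω, f ω * f ω ∂μ := by
  rw [← Lp.norm_toLp f hf, ← inner_toLp_eq_integral_mul hf hf, real_inner_self_eq_norm_sq]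

lemma integral_mul_le_toReal_eLpNorm_mul {Ω : Type*} {mΩ : MeasurableSpace Ω} {μ : Measure Ω}
    {f g : Ω → ℝ} (hf : MemLp f 2 μ) (hg : MemLp g 2 μ) :
    ∫ ω, f ω * g ω ∂μ ≤ (eLpNorm f 2 μ).toReal * (eLpNorm g 2 μ).toReal := by
  rw [← Lp.norm_toLp f hf, ← Lp.norm_toLp g hg, ← inner_toLp_eq_integral_mul hf hg]
  exact real_inner_le_norm _ _

/-- If `r ≤ a` and `r ≤ b`, then `r / (a * b) ≤ 1 / r`, which also holds when `r = 0`. -/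
lemma mul_div_mul_le_div {x c r a b : ℝ} (hx : x ≤ c) (hc : 0 ≤ c) (hr : 0 ≤ r)
    (ha : r ≤ a) (hb : r ≤ b) : x * r / (a * b) ≤ c / r := by
  rcases hr.eq_or_lt with rfl | hr
  · simp
  · have ha' := hr.trans_le ha
    have hb' := hr.trans_le hb
    rw [div_le_div_iff₀ (by positivity) hr, mul_assoc]
    exact mul_le_mul hx (mul_le_mul ha hb hr.le ha'.le) (by positivity) hc

/-- L² bound from the proof of Proposition 3.2: with `(S_α)`
square-integrable and `N` independent of the family with `P(N ≥ α) > 0` on a finite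
set `J`, the L² norm of `Σ_{α ∈ J} ΔS_α 1_{N ≥ α} / P(N ≥ α)` satisfies
`‖·‖₂² ≤ Σ_{α,β ∈ J} ‖ΔS_α‖₂ ‖ΔS_β‖₂ / P(N ≥ α ∨ β)`. -/
theorem L2_bound_estimator {d : ℕ} (hd : 1 ≤ d)
    {Ω : Type*} [MeasureSpace Ω] [IsProbabilityMeasure (ℙ : Measure Ω)]
    (S : (Fin d → ℕ) → Ω → ℝ) (hS : ∀ α, MemLp (S α) 2 ℙ)
    (N : Ω → (Fin d → ℕ)) (hN : Measurable N)
    (hind : IndepFun N (fun ω => fun α => S α ω) ℙ)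
    (J : Finset (Fin d → ℕ)) (hpos : ∀ α ∈ J, 0 < ℙ {ω | α ≤ N ω}) :
    (eLpNorm (fun ω => ∑ α ∈ J,
        mixedDiff (fun β => S β ω) α * Set.indicator {ω' | α ≤ N ω'} 1 ω
          / (ℙ {ω' | α ≤ N ω'}).toReal) 2 ℙ).toReal ^ 2
      ≤ ∑ α ∈ J, ∑ β ∈ J,
          (eLpNorm (fun ω => mixedDiff (fun γ => S γ ω) α) 2 ℙ).toReal
            * (eLpNorm (fun ω => mixedDiff (fun γ => S γ ω) β) 2 ℙ).toReal
            / (ℙ {ω | α ⊔ β ≤ N ω}).toReal := by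
  set D : (Fin d → ℕ) → Ω → ℝ := fun α ω => mixedDiff (fun β => S β ω) α
  set p : (Fin d → ℕ) → ℝ := fun α => (ℙ {ω' | α ≤ N ω'}).toReal
  have hDL : ∀ α, MemLp (D α) 2 ℙ := memLp_mixedDiff hS
  have hmeas : ∀ α, MeasurableSet {ω | α ≤ N ω} := fun α =>
    hN (Set.to_countable (Set.Ici α)).measurableSet
  set F : (Fin d → ℕ) → Ω → ℝ := fun α ω =>
    D α ω * Set.indicator {ω' | α ≤ N ω'} 1 ω / p α with hF
  have hFL : ∀ α, MemLp (F α) 2 ℙ := fun α => by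
    have h : F α = fun ω => (p α)⁻¹ * Set.indicator {ω' | α ≤ N ω'} (D α) ω := by
      ext ω
      by_cases hω : α ≤ N ω <;> simp [hF, hω, div_eq_inv_mul]
    rw [h]
    exact ((hDL α).indicator (hmeas α)).const_mul _
  have hcross : ∀ α β, ∫ ω, F α ω * F β ω =
      (∫ ω, D α ω * D β ω) * p (α ⊔ β) / (p α * p β) := fun α β => by
    have hg : Measurable (fun s : (Fin d → ℕ) → ℝ => mixedDiff s α * mixedDiff s β) :=
      (measurable_mixedDiff_apply α).mul (measurable_mixedDiff_apply β)
    have hi : Measurable (Set.indicator (Set.Ici (α ⊔ β)) (1 : (Fin d → ℕ) → ℝ)) :=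
      measurable_one.indicator (Set.to_countable _).measurableSet
    have hprod := (hind.symm.comp hg hi).integral_fun_mul_eq_mul_integral
      ((hDL α).aestronglyMeasurable.mul (hDL β).aestronglyMeasurable)
      (hi.comp hN).aestronglyMeasurable
    have hprob : ∫ ω, (Set.indicator (Set.Ici (α ⊔ β)) (1 : (Fin d → ℕ) → ℝ) ∘ N) ω =
        p (α ⊔ β) :=
      integral_indicator_one (hmeas (α ⊔ β))
    rw [hprob] at hprod
    have h : ∀ ω, F α ω * F β ω = (D α ω * D β ω *
        Set.indicator (Set.Ici (α ⊔ β)) (1 : (Fin d → ℕ) → ℝ) (N ω)) / (p α * p β) := fun ω => by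
      by_cases h₁ : α ≤ N ω <;> by_cases h₂ : β ≤ N ω <;>
        simp [hF, h₁, h₂, div_mul_div_comm]
    simp_rw [h]
    rw [integral_div]
    exact congrArg (· / (p α * p β)) hprod
  have hint : ∀ α β, Integrable (fun ω => F α ω * F β ω) ℙ := fun α β =>
    (hFL α).integrable_mul (hFL β)
  rw [toReal_eLpNorm_two_sq_eq_integral (memLp_finsetSum J fun α _ => hFL α)]
  simp_rw [Finset.sum_mul_sum]
  rw [integral_finsetSum _ fun α _ => integrable_finsetSum _ fun β _ => hint α β]
  refine Finset.sum_le_sum fun α _ => ?_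
  rw [integral_finsetSum _ fun β _ => hint α β]
  refine Finset.sum_le_sum fun β _ => ?_
  rw [hcross]
  exact mul_div_mul_le_div (integral_mul_le_toReal_eLpNorm_mul (hDL α) (hDL β))
    (by positivity) ENNReal.toReal_nonneg
    (measureReal_mono fun ω (hω : α ⊔ β ≤ N ω) => le_sup_left.trans hω)
    (measureReal_mono fun ω (hω : α ⊔ β ≤ N ω) => le_sup_right.trans hω)
end

section
/- (Second moment of the independent-sum estimator, finite form) Let (Δ̃_α)_{α ∈ ℕ^d} be square-integrable real random variables that are mutually independent across α, let n ∈ ℕ, and let N be an ℕ-valued random variable independent of the family (Δ̃_α), with P(N ≥ m) > 0 for all m ∈ {0,…,n}. Set s_m = Σ_{α ∈ I_0^m} E[Δ̃_α] for m ≥ 0 and s_{−1} = 0. Then the partial estimator Z̃'_n = Σ_{α ∈ I_0^n} Δ̃_α · 1_{{N ≥ |α|_∞}} / P(N ≥ |α|_∞) satisfies E[(Z̃'_n)²] = Σ_{α ∈ I_0^n} ( E[Δ̃_α²] + E[Δ̃_α] (2 s_n − s_{|α|_∞} − s_{|α|_∞ − 1} − E[Δ̃_α]) ) / P(N ≥ |α|_∞).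 -/
open MeasureTheory ProbabilityTheory

theorem mem_Iic_const_iff_sup_le {ι : Type*} [Fintype ι] [DecidableEq ι] (α : ι → ℕ) (m : ℕ) :
    α ∈ Finset.Iic ((fun _ => m) : ι → ℕ) ↔ Finset.univ.sup α ≤ m := by
  simp [Finset.mem_Iic, Pi.le_def]

theorem sum_Iic_const_eq_sum_ite {ι M : Type*} [Fintype ι] [DecidableEq ι] [AddCommMonoid M]
    (f : (ι → ℕ) → M) {m n : ℕ} (hmn : m ≤ n) :
    ∑ β ∈ Finset.Iic ((fun _ => m) : ι → ℕ), f β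
      = ∑ β ∈ Finset.Iic ((fun _ => n) : ι → ℕ),
          if Finset.univ.sup β ≤ m then f β else 0 := by
  rw [← Finset.sum_filter]
  congr 1
  ext β
  simp only [Finset.mem_filter, mem_Iic_const_iff_sup_le]
  omega

theorem ite_sum_Iic_pred_eq_sum_ite {ι M : Type*} [Fintype ι] [DecidableEq ι] [AddCommMonoid M]
    (f : (ι → ℕ) → M) {m n : ℕ} (hmn : m ≤ n) :
    (if m = 0 then 0 else ∑ β ∈ Finset.Iic ((fun _ => m - 1) : ι → ℕ), f β)
      = ∑ β ∈ Finset.Iic ((fun _ => n) : ι → ℕ),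
          if Finset.univ.sup β < m then f β else 0 := by
  split_ifs with hm
  · simp [hm]
  · rw [sum_Iic_const_eq_sum_ite f (show m - 1 ≤ n by omega)]
    refine Finset.sum_congr rfl fun β _ => ?_
    congr 1
    exact propext (by omega)

/-- Summation over pairs of a weight depending on the minimum of the levels. -/
theorem sum_sum_mul_min {ι R : Type*} [CommRing R] (S : Finset ι) (h : ι → ℕ) (μ : ι → R)
    (q : ℕ → R) :
    ∑ α ∈ S, ∑ β ∈ S, μ α * μ β * q (min (h α) (h β))
      = ∑ α ∈ S, μ α * (2 * (∑ β ∈ S, μ β) - (∑ β ∈ S, if h β ≤ h α then μ β else 0)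
          - ∑ β ∈ S, if h β < h α then μ β else 0) * q (h α) := by
  have hsplit : ∀ α β, μ α * μ β * q (min (h α) (h β))
      = (μ α * (μ β - if h β < h α then μ β else 0) * q (h α))
        + μ β * (μ α - if h α ≤ h β then μ α else 0) * q (h β) := by
    intro α β
    rcases lt_or_ge (h β) (h α) with hlt | hge
    · simp [hlt, hlt.le, not_le.2 hlt]; ring
    · simp [hge, not_lt.2 hge]
  simp_rw [hsplit, Finset.sum_add_distrib]
  rw [Finset.sum_comm (f := fun α β => μ β * (μ α - if h α ≤ h β then μ α else 0) * q (h β)),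
    ← Finset.sum_add_distrib]
  refine Finset.sum_congr rfl fun α _ => ?_
  simp_rw [← Finset.sum_mul, ← Finset.mul_sum, Finset.sum_sub_distrib]
  ring

/-- The weighted cross moment of two terms factorises through the minimum of the two levels. -/
theorem integral_mul_indicator_div_mul {Ω : Type*} [MeasurableSpace Ω] {P : Measure Ω}
    [IsProbabilityMeasure P] {N : Ω → ℕ} (hN : Measurable N) {X Y : Ω → ℝ}
    (hX : AEStronglyMeasurable X P) (hY : AEStronglyMeasurable Y P)
    (hind : IndepFun N (fun ω => X ω * Y ω) P) {a b : ℕ}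
    (ha : 0 < P {ω | a ≤ N ω}) (hb : 0 < P {ω | b ≤ N ω}) :
    ∫ ω, (X ω * Set.indicator {ω' | a ≤ N ω'} 1 ω / (P {ω' | a ≤ N ω'}).toReal)
        * (Y ω * Set.indicator {ω' | b ≤ N ω'} 1 ω / (P {ω' | b ≤ N ω'}).toReal) ∂P
      = (∫ ω, X ω * Y ω ∂P) * ((P {ω | min a b ≤ N ω}).toReal)⁻¹ := by
  have ha' : (P {ω | a ≤ N ω}).toReal ≠ 0 := (ENNReal.toReal_pos ha.ne' (measure_ne_top _ _)).ne'
  have hb' : (P {ω | b ≤ N ω}).toReal ≠ 0 := (ENNReal.toReal_pos hb.ne' (measure_ne_top _ _)).ne'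
  have hmeas : MeasurableSet {ω | max a b ≤ N ω} := measurableSet_le measurable_const hN
  set g : ℕ → ℝ := Set.indicator {k | max a b ≤ k} 1 with hg
  have hgN : ∀ ω, g (N ω) = Set.indicator {ω' | max a b ≤ N ω'} 1 ω := fun ω => rfl
  have hcomp : IndepFun (fun ω => g (N ω)) (fun ω => X ω * Y ω) P :=
    hind.comp (φ := g) (ψ := id) (measurable_of_countable g) measurable_id
  have hprod := hcomp.integral_fun_mul_eq_mul_integral
    ((measurable_of_countable g).comp hN).aestronglyMeasurable (hX.mul hY)
  have h_integral : ∫ ω, g (N ω) ∂P = (P {ω | max a b ≤ N ω}).toReal := by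
    simp_rw [hgN]
    rw [integral_indicator_one hmeas, measureReal_def]
  have hpt : ∀ ω,
      (X ω * Set.indicator {ω' | a ≤ N ω'} 1 ω / (P {ω' | a ≤ N ω'}).toReal)
        * (Y ω * Set.indicator {ω' | b ≤ N ω'} 1 ω / (P {ω' | b ≤ N ω'}).toReal)
      = g (N ω) * (X ω * Y ω)
        * ((P {ω' | a ≤ N ω'}).toReal * (P {ω' | b ≤ N ω'}).toReal)⁻¹ := by
    intro ω
    have : g (N ω) = Set.indicator {ω' | a ≤ N ω'} (1 : Ω → ℝ) ω
        * Set.indicator {ω' | b ≤ N ω'} (1 : Ω → ℝ) ω := by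
      by_cases h1 : a ≤ N ω <;> by_cases h2 : b ≤ N ω <;>
        simp [hg, h1, h2]
    rw [this]
    field_simp
  simp_rw [hpt]
  rw [integral_mul_const, hprod, h_integral]
  rcases le_total a b with h | h
  · rw [max_eq_right h, min_eq_left h]; field_simp
  · rw [max_eq_left h, min_eq_right h]; field_simp

/-- second moment of the independent-sum estimator, finite form:
with `(Δ̃_α)` square-integrable and mutually independent across `α`, `N` an
`ℕ`-valued random variable independent of the family with `P(N ≥ m) > 0` for
`m ∈ {0,…,n}`, and `s_m = Σ_{α ∈ I_0^m} E[Δ̃_α]` (with `s_{−1} = 0`), the partial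
estimator `Z̃'_n = Σ_{α ∈ I_0^n} Δ̃_α 1_{N ≥ |α|_∞} / P(N ≥ |α|_∞)` satisfies
`E[(Z̃'_n)²] = Σ_{α ∈ I_0^n} (E[Δ̃_α²] + E[Δ̃_α](2s_n − s_{|α|_∞} − s_{|α|_∞−1} − E[Δ̃_α]))
 / P(N ≥ |α|_∞)`. -/
theorem secondMoment_independent_sum_estimator {d : ℕ} (hd : 1 ≤ d)
    {Ω : Type*} [MeasureSpace Ω] [IsProbabilityMeasure (ℙ : Measure Ω)]
    (Δt : (Fin d → ℕ) → Ω → ℝ) (hΔt : ∀ α, MemLp (Δt α) 2 ℙ)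
    (hmut : iIndepFun Δt ℙ)
    (n : ℕ)
    (N : Ω → ℕ) (hN : Measurable N)
    (hind : IndepFun N (fun ω => fun α => Δt α ω) ℙ)
    (hpos : ∀ m ≤ n, 0 < ℙ {ω | m ≤ N ω}) :
    ∫ ω, (∑ α ∈ Finset.Iic ((fun _ => n) : Fin d → ℕ),
        Δt α ω * Set.indicator {ω' | Finset.univ.sup α ≤ N ω'} 1 ω
          / (ℙ {ω' | Finset.univ.sup α ≤ N ω'}).toReal) ^ 2 ∂ℙ
      = ∑ α ∈ Finset.Iic ((fun _ => n) : Fin d → ℕ),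
          ((∫ ω, (Δt α ω) ^ 2 ∂ℙ)
            + (∫ ω, Δt α ω ∂ℙ)
              * (2 * (∑ β ∈ Finset.Iic ((fun _ => n) : Fin d → ℕ), ∫ ω, Δt β ω ∂ℙ)
                - (∑ β ∈ Finset.Iic ((fun _ => Finset.univ.sup α) : Fin d → ℕ),
                    ∫ ω, Δt β ω ∂ℙ)
                - (if Finset.univ.sup α = 0 then 0
                   else ∑ β ∈ Finset.Iic ((fun _ => Finset.univ.sup α - 1) : Fin d → ℕ),
                     ∫ ω, Δt β ω ∂ℙ)
                - ∫ ω, Δt α ω ∂ℙ))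
            / (ℙ {ω | Finset.univ.sup α ≤ N ω}).toReal := by
  set S := Finset.Iic ((fun _ => n) : Fin d → ℕ)
  set q : ℕ → ℝ := fun m => ((ℙ {ω | m ≤ N ω}).toReal)⁻¹ with hq
  have hlevel : ∀ α ∈ S, Finset.univ.sup α ≤ n := fun α hα =>
    (mem_Iic_const_iff_sup_le α n).1 hα
  have hterm : ∀ α, MemLp (fun ω => Δt α ω * Set.indicator {ω' | Finset.univ.sup α ≤ N ω'} 1 ω
      / (ℙ {ω' | Finset.univ.sup α ≤ N ω'}).toReal) 2 ℙ := by
    intro α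
    have hmeas : MeasurableSet {ω | Finset.univ.sup α ≤ N ω} :=
      measurableSet_le measurable_const hN
    refine (((hΔt α).indicator hmeas).mul_const
      ((ℙ {ω' | Finset.univ.sup α ≤ N ω'}).toReal)⁻¹).ae_eq (.of_forall fun ω => ?_)
    simp only [Set.indicator, Set.mem_ofPred_eq, Pi.one_apply, div_eq_mul_inv, mul_ite, mul_one,
      mul_zero]
    congr
  have hterm_mul : ∀ α β, Integrable (fun ω =>
      (Δt α ω * Set.indicator {ω' | Finset.univ.sup α ≤ N ω'} 1 ω
          / (ℙ {ω' | Finset.univ.sup α ≤ N ω'}).toReal)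
        * (Δt β ω * Set.indicator {ω' | Finset.univ.sup β ≤ N ω'} 1 ω
          / (ℙ {ω' | Finset.univ.sup β ≤ N ω'}).toReal)) ℙ :=
    fun α β => (hterm α).integrable_mul (hterm β)
  have hcross : ∀ α β, ∫ ω, Δt α ω * Δt β ω ∂ℙ
      = (∫ ω, Δt α ω ∂ℙ) * (∫ ω, Δt β ω ∂ℙ)
        + if α = β then (∫ ω, (Δt α ω) ^ 2 ∂ℙ) - (∫ ω, Δt α ω ∂ℙ) ^ 2 else 0 := by
    intro α β
    split_ifs with h
    · subst h
      simp_rw [← pow_two]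
      ring
    · rw [add_zero]
      exact (hmut.indepFun h).integral_fun_mul_eq_mul_integral
        (hΔt α).aestronglyMeasurable (hΔt β).aestronglyMeasurable
  have hpair : ∀ α ∈ S, ∀ β ∈ S,
      ∫ ω, (Δt α ω * Set.indicator {ω' | Finset.univ.sup α ≤ N ω'} 1 ω
          / (ℙ {ω' | Finset.univ.sup α ≤ N ω'}).toReal)
        * (Δt β ω * Set.indicator {ω' | Finset.univ.sup β ≤ N ω'} 1 ω
          / (ℙ {ω' | Finset.univ.sup β ≤ N ω'}).toReal) ∂ℙ
      = (∫ ω, Δt α ω ∂ℙ) * (∫ ω, Δt β ω ∂ℙ) * q (min (Finset.univ.sup α) (Finset.univ.sup β))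
        + if α = β then ((∫ ω, (Δt α ω) ^ 2 ∂ℙ) - (∫ ω, Δt α ω ∂ℙ) ^ 2)
            * q (Finset.univ.sup α) else 0 := by
    intro α hα β hβ
    rw [integral_mul_indicator_div_mul hN (hΔt α).aestronglyMeasurable
      (hΔt β).aestronglyMeasurable
      (hind.comp (φ := id) (ψ := fun x : (Fin d → ℕ) → ℝ => x α * x β) measurable_id
        ((measurable_pi_apply α).mul (measurable_pi_apply β)))
      (hpos _ (hlevel α hα)) (hpos _ (hlevel β hβ)), hcross, add_mul]
    split_ifs with h
    · subst h
      simp [hq]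
    · simp [hq]
  simp_rw [pow_two (∑ α ∈ S, _), Finset.sum_mul_sum]
  rw [integral_finsetSum _ fun α _ => integrable_finsetSum _ fun β _ =>
    hterm_mul α β]
  rw [Finset.sum_congr rfl fun α hα => (integral_finsetSum _ fun β _ =>
    hterm_mul α β).trans (Finset.sum_congr rfl (hpair α hα))]
  simp_rw [Finset.sum_add_distrib]
  rw [sum_sum_mul_min S (fun α => Finset.univ.sup α) (fun α => ∫ ω, Δt α ω ∂ℙ) q,
    ← Finset.sum_add_distrib]
  refine Finset.sum_congr rfl fun α hα => ?_
  rw [sum_Iic_const_eq_sum_ite _ (hlevel α hα), ite_sum_Iic_pred_eq_sum_ite _ (hlevel α hα),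
    Finset.sum_ite_eq, if_pos hα, div_eq_mul_inv]
  ring
end
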